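/- Let 𝒰 be a finite set and let S : Set 𝒰 → Σ be a composable sketching map with unique cores. Then for all U₁, U₂ ⊆ 𝒰, core(S(U₁ ∪ U₂)) ⊆ core(S(U₁)) ∪ core(S(U₂)). -/

import Mathlib

/-- A sketching map `S` on ground set `𝒰` is *composable* if there is a binary
operation `op` on sketch values with `S (A ∪ B) = op (S A) (S B)` for all `A B`. -/
def Composable {𝒰 T : Type*} (S : Set 𝒰 → T) : Prop :=
  ∃ op : T → T → T, ∀ A B : Set 𝒰, S (A ∪ B) = op (S A) (S B)

/-- `C` is a *core* of the sketch value `σ`: `S C = σ` and no proper subset of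
`C` has sketch `σ`. -/
def IsCore {𝒰 T : Type*} (S : Set 𝒰 → T) (σ : T) (C : Set 𝒰) : Prop :=
  S C = σ ∧ ∀ C' : Set 𝒰, C' ⊂ C → S C' ≠ σ

/-- On a finite ground set, every set contains a core of its sketch value. -/
theorem exists_isCore_subset {𝒰 T : Type*} [Finite 𝒰] (S : Set 𝒰 → T) (A : Set 𝒰) :
    ∃ C ⊆ A, IsCore S (S A) C := by
  obtain ⟨C, hCA, hC⟩ :=
    (Set.toFinite {B : Set 𝒰 | S B = S A}).exists_le_minimal (a := A) rfl
  exact ⟨C, hCA, hC.prop, fun C' hlt h => hC.not_prop_of_lt hlt h⟩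

/-- Core of a union is contained in the union of the cores, for a composable
sketching map with unique cores (the unique core of each sketch value in the
image of `S` is given by the function `core`). -/
theorem stmt6 {𝒰 T : Type*} [Fintype 𝒰] (S : Set 𝒰 → T) (hS : Composable S)
    (core : T → Set 𝒰)
    (hcore : ∀ σ ∈ Set.range S,
      IsCore S σ (core σ) ∧ ∀ C : Set 𝒰, IsCore S σ C → C = core σ)
    (U₁ U₂ : Set 𝒰) :
    core (S (U₁ ∪ U₂)) ⊆ core (S U₁) ∪ core (S U₂) := by
  obtain ⟨op, hop⟩ := hS
  have hS_union : S (core (S U₁) ∪ core (S U₂)) = S (U₁ ∪ U₂) := by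
    rw [hop, hop, (hcore _ ⟨U₁, rfl⟩).1.1, (hcore _ ⟨U₂, rfl⟩).1.1]
  obtain ⟨C, hC_sub, hC⟩ := exists_isCore_subset S (core (S U₁) ∪ core (S U₂))
  rw [hS_union] at hC
  exact (hcore _ ⟨_, rfl⟩).2 C hC ▸ hC_sub
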